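/- (Lemma 2, bijectivity.) The map f sending a nonsingular vector x to the pair (P, H) = ((span{x}^⊥ ⊓ Π)^⊥ ⊓ Σ, span{x}^⊥ ⊓ Σ) is a bijection from the set of nonsingular vectors of V(2n,2) onto the set of point-hyperplane antiflags of Σ, i.e. onto the set of pairs (P, H) of subspaces of Σ with dim P = 1, dim H = n − 1, and P not contained in H. -/

import Mathlib

/-- The hyperbolic quadratic form on `V(2n,2)`:
`Q x = ∑_{i=0}^{n-1} x (2i) * x (2i+1)`. -/
def Q (n : ℕ) (x : Fin (2*n) → ZMod 2) : ZMod 2 :=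
  ∑ i : Fin n, x ⟨2*i.1, by have := i.2; omega⟩ * x ⟨2*i.1+1, by have := i.2; omega⟩

/-- The bilinear form associated with `Q`: `B u v = Q (u+v) + Q u + Q v`. -/
def B (n : ℕ) (u v : Fin (2*n) → ZMod 2) : ZMod 2 :=
  Q n (u + v) + Q n u + Q n v

lemma B_eq (n : ℕ) (u v : Fin (2*n) → ZMod 2) :
    B n u v = ∑ i : Fin n,
      (u ⟨2*i.1, by have := i.2; omega⟩ * v ⟨2*i.1+1, by have := i.2; omega⟩
        + u ⟨2*i.1+1, by have := i.2; omega⟩ * v ⟨2*i.1, by have := i.2; omega⟩) := by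
  have key : ∀ a b c d : ZMod 2, (a+c)*(b+d) + a*b + c*d = a*d + c*b := by decide
  simp only [B, Q, Pi.add_apply, ← Finset.sum_add_distrib]
  exact Finset.sum_congr rfl fun i _ => by rw [key]; ring

lemma B_add_left (n : ℕ) (u v w : Fin (2*n) → ZMod 2) :
    B n (u + v) w = B n u w + B n v w := by
  simp only [B_eq, Pi.add_apply, ← Finset.sum_add_distrib]
  exact Finset.sum_congr rfl fun i _ => by ring

lemma B_smul_left (n : ℕ) (c : ZMod 2) (v w : Fin (2*n) → ZMod 2) :
    B n (c • v) w = c * B n v w := by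
  simp only [B_eq, Pi.smul_apply, smul_eq_mul, Finset.mul_sum]
  exact Finset.sum_congr rfl fun i _ => by ring

/-- The perp `S^⊥ = {v : B v s = 0 for all s ∈ S}` of a subspace `S`
with respect to the bilinear form `B`. -/
def perp (n : ℕ) (S : Submodule (ZMod 2) (Fin (2*n) → ZMod 2)) :
    Submodule (ZMod 2) (Fin (2*n) → ZMod 2) where
  carrier := {v | ∀ s ∈ S, B n v s = 0}
  zero_mem' := by intro s _; simp [B_eq]
  add_mem' := by
    intro a b ha hb s hs
    rw [B_add_left, ha s hs, hb s hs, add_zero]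
  smul_mem' := by
    intro c v hv s hs
    rw [B_smul_left, hv s hs, mul_zero]

/-- `Π`, the span of the even-indexed standard basis vectors `e_{2i}`,
a maximal totally singular subspace. -/
def PiSub (n : ℕ) : Submodule (ZMod 2) (Fin (2*n) → ZMod 2) :=
  Submodule.span (ZMod 2) {v | ∃ j : Fin (2*n), j.1 % 2 = 0 ∧ v = Pi.single j 1}

/-- `Σ`, the span of the odd-indexed standard basis vectors `e_{2i+1}`,
a maximal totally singular subspace disjoint from `Π`. -/
def SigmaSub (n : ℕ) : Submodule (ZMod 2) (Fin (2*n) → ZMod 2) :=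
  Submodule.span (ZMod 2) {v | ∃ j : Fin (2*n), j.1 % 2 = 1 ∧ v = Pi.single j 1}

/-- The map `f` sending a nonsingular vector `x` to the antiflag
`(P, H) = ((span{x}^⊥ ⊓ Π)^⊥ ⊓ Σ, span{x}^⊥ ⊓ Σ)` of `Σ`. -/
def antiflagMap (n : ℕ) (x : Fin (2*n) → ZMod 2) :
    Submodule (ZMod 2) (Fin (2*n) → ZMod 2) × Submodule (ZMod 2) (Fin (2*n) → ZMod 2) :=
  (perp n (perp n (Submodule.span (ZMod 2) {x}) ⊓ PiSub n) ⊓ SigmaSub n,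
   perp n (Submodule.span (ZMod 2) {x}) ⊓ SigmaSub n)

/-- The even-indexed coordinates of a vector of `V(2n,2)`. -/
def evenPart (n : ℕ) (x : Fin (2*n) → ZMod 2) (i : Fin n) : ZMod 2 :=
  x ⟨2*i.1, by have := i.2; omega⟩

/-- The odd-indexed coordinates of a vector of `V(2n,2)`. -/
def oddPart (n : ℕ) (x : Fin (2*n) → ZMod 2) (i : Fin n) : ZMod 2 :=
  x ⟨2*i.1+1, by have := i.2; omega⟩

/-- The linear map interleaving even-indexed and odd-indexed coordinates. -/
def interleave (n : ℕ) :
    ((Fin n → ZMod 2) × (Fin n → ZMod 2)) →ₗ[ZMod 2] (Fin (2*n) → ZMod 2) where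
  toFun ab := fun j => if j.1 % 2 = 0 then ab.1 ⟨j.1/2, by have := j.2; omega⟩
    else ab.2 ⟨j.1/2, by have := j.2; omega⟩
  map_add' a b := by ext j; dsimp; split_ifs <;> rfl
  map_smul' c a := by ext j; dsimp; split_ifs <;> rfl

lemma evenPart_interleave (n : ℕ) (ab : (Fin n → ZMod 2) × (Fin n → ZMod 2)) :
    evenPart n (interleave n ab) = ab.1 := by
  ext i
  simp [evenPart, interleave]

lemma oddPart_interleave (n : ℕ) (ab : (Fin n → ZMod 2) × (Fin n → ZMod 2)) :
    oddPart n (interleave n ab) = ab.2 := by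
  ext i
  have h1 : (2 * i.1 + 1) / 2 = i.1 := by omega
  have h2 : (2 * i.1 + 1) % 2 = 1 := by omega
  simp [oddPart, interleave, h1, h2]

lemma interleave_parts (n : ℕ) (x : Fin (2*n) → ZMod 2) :
    interleave n (evenPart n x, oddPart n x) = x := by
  ext j
  by_cases h : j.1 % 2 = 0
  · have h1 : 2 * (j.1 / 2) = j.1 := by omega
    simp [interleave, evenPart, h, h1]
  · have h1 : 2 * (j.1 / 2) + 1 = j.1 := by omega
    simp [interleave, oddPart, h, h1]

lemma Q_eq_dotProduct (n : ℕ) (x : Fin (2*n) → ZMod 2) :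
    Q n x = evenPart n x ⬝ᵥ oddPart n x := rfl

lemma B_eq_dotProduct (n : ℕ) (u v : Fin (2*n) → ZMod 2) :
    B n u v = evenPart n u ⬝ᵥ oddPart n v + oddPart n u ⬝ᵥ evenPart n v := by
  rw [B_eq, Finset.sum_add_distrib]
  rfl

lemma mem_perp_span_singleton (n : ℕ) (x v : Fin (2*n) → ZMod 2) :
    v ∈ perp n (Submodule.span (ZMod 2) {x}) ↔
      evenPart n v ⬝ᵥ oddPart n x + oddPart n v ⬝ᵥ evenPart n x = 0 := by
  rw [← B_eq_dotProduct]
  refine ⟨fun h => h x (Submodule.mem_span_singleton_self x), fun h s hs => ?_⟩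
  obtain ⟨c, rfl⟩ := Submodule.mem_span_singleton.1 hs
  have hc : ∀ c : ZMod 2, c = 0 ∨ c = 1 := by decide
  rcases hc c with rfl | rfl
  · simp [B_eq]
  · rwa [one_smul]

/-- The span of the standard basis vectors with index in `{j | p j}` consists of the vectors
vanishing outside `{j | p j}`. -/
lemma mem_span_single_iff {m : ℕ} (p : Fin m → Prop) (x : Fin m → ZMod 2) :
    x ∈ Submodule.span (ZMod 2) {v | ∃ j : Fin m, p j ∧ v = Pi.single j 1} ↔
      ∀ j, ¬ p j → x j = 0 := by
  constructor
  · intro hx j hj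
    induction hx using Submodule.span_induction with
    | mem v hv =>
      obtain ⟨k, hk, rfl⟩ := hv
      exact Pi.single_eq_of_ne (by rintro rfl; exact hj hk) 1
    | zero => rfl
    | add u v _ _ hu hv => simp [hu, hv]
    | smul c v _ hv => simp [hv]
  · intro h
    rw [pi_eq_sum_univ' x]
    refine Submodule.sum_mem _ fun j _ => ?_
    by_cases hj : p j
    · refine Submodule.smul_mem _ _ (Submodule.subset_span ⟨j, hj, ?_⟩)
      ext k
      simp [Pi.single_apply, eq_comm]
    · simp [h j hj]

lemma mem_PiSub_iff (n : ℕ) (x : Fin (2*n) → ZMod 2) :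
    x ∈ PiSub n ↔ oddPart n x = 0 := by
  rw [PiSub, mem_span_single_iff (fun j => j.1 % 2 = 0)]
  refine ⟨fun h => funext fun i => h _ (by dsimp; omega), fun h j hj => ?_⟩
  rw [← interleave_parts n x, h]
  simp [interleave, hj]

lemma mem_SigmaSub_iff (n : ℕ) (x : Fin (2*n) → ZMod 2) :
    x ∈ SigmaSub n ↔ evenPart n x = 0 := by
  rw [SigmaSub, mem_span_single_iff (fun j => j.1 % 2 = 1)]
  refine ⟨fun h => funext fun i => h _ (by dsimp; omega), fun h j hj => ?_⟩
  rw [← interleave_parts n x, h]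
  simp [interleave, show j.1 % 2 = 0 by omega]

/-- The embedding of `V(n,2)` onto `Σ`. -/
def sigmaIncl (n : ℕ) : (Fin n → ZMod 2) →ₗ[ZMod 2] (Fin (2*n) → ZMod 2) :=
  interleave n ∘ₗ LinearMap.inr _ _ _

lemma evenPart_sigmaIncl (n : ℕ) (w : Fin n → ZMod 2) : evenPart n (sigmaIncl n w) = 0 :=
  evenPart_interleave n (0, w)

lemma oddPart_sigmaIncl (n : ℕ) (w : Fin n → ZMod 2) : oddPart n (sigmaIncl n w) = w :=
  oddPart_interleave n (0, w)

lemma sigmaIncl_injective (n : ℕ) : Function.Injective (sigmaIncl n) :=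
  Function.LeftInverse.injective (g := oddPart n) (oddPart_sigmaIncl n)

lemma range_sigmaIncl (n : ℕ) : LinearMap.range (sigmaIncl n) = SigmaSub n := by
  ext x
  rw [mem_SigmaSub_iff]
  constructor
  · rintro ⟨w, rfl⟩
    exact evenPart_sigmaIncl n w
  · intro h
    exact ⟨oddPart n x, by rw [← interleave_parts n x, h]; simp [sigmaIncl, oddPart_interleave]⟩

/-- `S ⊓ Σ` is the image of `T` if membership in `S` of vectors of `Σ` is given by `T`. -/
lemma inf_SigmaSub_eq_map (n : ℕ) (S : Submodule (ZMod 2) (Fin (2*n) → ZMod 2))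
    (T : Submodule (ZMod 2) (Fin n → ZMod 2)) (h : ∀ w, sigmaIncl n w ∈ S ↔ w ∈ T) :
    S ⊓ SigmaSub n = T.map (sigmaIncl n) := by
  rw [← range_sigmaIncl, inf_comm, ← Submodule.map_comap_eq]
  congr 1
  ext w
  exact h w

/-- The hyperplane (or whole space) of vectors orthogonal to `p` for the dot product. -/
def dotKer {n : ℕ} (p : Fin n → ZMod 2) : Submodule (ZMod 2) (Fin n → ZMod 2) :=
  LinearMap.ker (dotProductBilin (ZMod 2) (ZMod 2) p)

lemma mem_dotKer {n : ℕ} (p w : Fin n → ZMod 2) : w ∈ dotKer p ↔ p ⬝ᵥ w = 0 := Iff.rfl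

/-- The double orthogonal of a vector for the dot product is its span. -/
lemma forall_dotProduct_eq_zero_iff {n : ℕ} (q w : Fin n → ZMod 2) :
    (∀ a, a ⬝ᵥ q = 0 → w ⬝ᵥ a = 0) ↔ w ∈ Submodule.span (ZMod 2) {q} := by
  rw [Submodule.mem_span_singleton]
  constructor
  · intro h
    by_cases hq : q = 0
    · refine ⟨0, funext fun j => ?_⟩
      simpa using (h (Pi.single j 1) (by simp [hq])).symm
    · obtain ⟨i, hi⟩ := Function.ne_iff.1 hq
      have hi : q i = 1 := (show ∀ c : ZMod 2, c ≠ 0 → c = 1 by decide) _ hi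
      refine ⟨w i, funext fun j => ?_⟩
      have := h (Pi.single j 1 - Pi.single i (q j)) (by simp [sub_dotProduct, hi])
      rw [dotProduct_sub, dotProduct_single, dotProduct_single, mul_one, sub_eq_zero] at this
      simp [this]
  · rintro ⟨c, rfl⟩ a ha
    rw [smul_dotProduct, dotProduct_comm, ha, smul_zero]

lemma antiflagMap_eq (n : ℕ) (x : Fin (2*n) → ZMod 2) :
    antiflagMap n x = ((Submodule.span (ZMod 2) {oddPart n x}).map (sigmaIncl n),
      (dotKer (evenPart n x)).map (sigmaIncl n)) := by
  refine Prod.ext (inf_SigmaSub_eq_map n _ _ fun w => ?_) (inf_SigmaSub_eq_map n _ _ fun w => ?_)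
  · rw [← forall_dotProduct_eq_zero_iff]
    constructor
    · intro h a ha
      have := h (interleave n (a, 0))
        ⟨by simpa [mem_perp_span_singleton, evenPart_interleave, oddPart_interleave] using ha,
          by simp [mem_PiSub_iff, oddPart_interleave]⟩
      simpa [B_eq_dotProduct, evenPart_sigmaIncl, oddPart_sigmaIncl, evenPart_interleave]
        using this
    · rintro h s ⟨hs, hsP⟩
      have hs := (mem_perp_span_singleton n x s).1 hs
      have hsP := (mem_PiSub_iff n s).1 hsP
      rw [hsP, zero_dotProduct, add_zero] at hs
      simpa [B_eq_dotProduct, evenPart_sigmaIncl, oddPart_sigmaIncl] using h _ hs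
  · rw [mem_perp_span_singleton, mem_dotKer, evenPart_sigmaIncl, oddPart_sigmaIncl,
      zero_dotProduct, zero_add, dotProduct_comm]

lemma dotKer_injective {n : ℕ} : Function.Injective (dotKer (n := n)) := by
  intro p p' h
  ext i
  have hi : p i = 0 ↔ p' i = 0 := by
    simpa [mem_dotKer] using SetLike.ext_iff.1 h (Pi.single i 1)
  exact (show ∀ a b : ZMod 2, (a = 0 ↔ b = 0) → a = b by decide) _ _ hi

lemma finrank_dotKer {n : ℕ} {p : Fin n → ZMod 2} (hp : p ≠ 0) :
    Module.finrank (ZMod 2) (dotKer p) = n - 1 := by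
  have hf : dotProductBilin (ZMod 2) (ZMod 2) p ≠ 0 := fun h =>
    hp (dotProduct_eq_zero p fun w => LinearMap.congr_fun h w)
  have h := Module.Dual.finrank_ker_add_one_of_ne_zero hf
  rw [Module.finrank_fin_fun] at h
  exact Nat.eq_sub_of_add_eq h

lemma exists_eq_dotKer {n : ℕ} (hn : 0 < n) (H : Submodule (ZMod 2) (Fin n → ZMod 2))
    (hH : Module.finrank (ZMod 2) H = n - 1) : ∃ p, H = dotKer p := by
  have hlt : H < ⊤ := lt_top_iff_ne_top.2 fun h => by
    rw [h, finrank_top, Module.finrank_fin_fun] at hH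
    omega
  obtain ⟨f, hf, hle⟩ := H.exists_le_ker_of_lt_top hlt
  have hfp : f = dotProductBilin (ZMod 2) (ZMod 2) (fun i => f (Pi.single i 1)) :=
    LinearMap.pi_ext' fun i => LinearMap.ext_ring (by simp [dotProductBilin])
  have hker : LinearMap.ker f = dotKer fun i => f (Pi.single i 1) := congrArg LinearMap.ker hfp
  have h := Module.Dual.finrank_ker_add_one_of_ne_zero hf
  rw [Module.finrank_fin_fun] at h
  exact ⟨_, (Submodule.eq_of_le_of_finrank_eq hle (by omega)).trans hker⟩

lemma span_singleton_injective {n : ℕ} :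
    Function.Injective fun q : Fin n → ZMod 2 => Submodule.span (ZMod 2) {q} := by
  intro q q' h
  obtain ⟨c, hc⟩ := Submodule.span_singleton_eq_span_singleton.1 h
  rwa [Subsingleton.elim c 1, one_smul] at hc

/-- Lemma 2 (bijectivity): the map `f` is a bijection from the set of nonsingular vectors
of `V(2n,2)` onto the set of point-hyperplane antiflags `(P, H)` of `Σ`, i.e. pairs of
subspaces of `Σ` with `dim P = 1`, `dim H = n - 1` and `P` not contained in `H`. -/
theorem antiflagMap_bijective (n : ℕ) (hn : 2 ≤ n) :
    Set.BijOn (antiflagMap n) {x | Q n x = 1}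
      {PH : Submodule (ZMod 2) (Fin (2*n) → ZMod 2) ×
          Submodule (ZMod 2) (Fin (2*n) → ZMod 2) |
        PH.1 ≤ SigmaSub n ∧ PH.2 ≤ SigmaSub n ∧
        Module.finrank (ZMod 2) PH.1 = 1 ∧ Module.finrank (ZMod 2) PH.2 = n - 1 ∧
        ¬ PH.1 ≤ PH.2} := by
  have hinj := Submodule.map_injective_of_injective (sigmaIncl_injective n)
  have hle (T : Submodule (ZMod 2) (Fin n → ZMod 2)) : T.map (sigmaIncl n) ≤ SigmaSub n :=
    range_sigmaIncl n ▸ LinearMap.map_le_range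
  have hrank (T : Submodule (ZMod 2) (Fin n → ZMod 2)) :
      Module.finrank (ZMod 2) (T.map (sigmaIncl n)) = Module.finrank (ZMod 2) T :=
    (Submodule.equivMapOfInjective _ (sigmaIncl_injective n) T).finrank_eq.symm
  have hmem (p q : Fin n → ZMod 2) :
      (Submodule.span (ZMod 2) {q}).map (sigmaIncl n) ≤ (dotKer p).map (sigmaIncl n) ↔
        p ⬝ᵥ q = 0 := by
    rw [Submodule.map_le_map_iff_of_injective (sigmaIncl_injective n),
      Submodule.span_singleton_le_iff_mem, mem_dotKer]
  refine ⟨fun x hx => ?_, fun x _ y _ hxy => ?_, ?_⟩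
  · have hx : evenPart n x ⬝ᵥ oddPart n x = 1 := hx
    have hp : evenPart n x ≠ 0 := fun h => by simp [h] at hx
    have hq : oddPart n x ≠ 0 := fun h => by simp [h] at hx
    rw [antiflagMap_eq]
    refine ⟨hle _, hle _, ?_, ?_, ?_⟩
    · rw [hrank, finrank_span_singleton hq]
    · rw [hrank, finrank_dotKer hp]
    · rw [hmem, hx]
      exact one_ne_zero
  · rw [antiflagMap_eq, antiflagMap_eq, Prod.mk.injEq] at hxy
    rw [← interleave_parts n x, ← interleave_parts n y, dotKer_injective (hinj hxy.2),
      span_singleton_injective (hinj hxy.1)]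
  · rintro ⟨P, H⟩ ⟨hP, hH, hPrank, hHrank, hPH⟩
    dsimp only at hP hH hPrank hHrank hPH
    rw [← range_sigmaIncl] at hP hH
    obtain ⟨P, rfl⟩ : ∃ P', Submodule.map (sigmaIncl n) P' = P :=
      ⟨_, Submodule.map_comap_eq_self hP⟩
    obtain ⟨H, rfl⟩ : ∃ H', Submodule.map (sigmaIncl n) H' = H :=
      ⟨_, Submodule.map_comap_eq_self hH⟩
    rw [hrank] at hPrank hHrank
    obtain ⟨p, rfl⟩ := exists_eq_dotKer (by omega) H hHrank
    obtain ⟨q, rfl⟩ : ∃ q, Submodule.span (ZMod 2) {q} = P := by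
      obtain ⟨q, -, hq⟩ := finrank_eq_one_iff'.1 hPrank
      refine ⟨q, le_antisymm ((Submodule.span_singleton_le_iff_mem _ _).2 q.2) fun w hw => ?_⟩
      obtain ⟨c, hc⟩ := hq ⟨w, hw⟩
      exact Submodule.mem_span_singleton.2 ⟨c, congrArg Subtype.val hc⟩
    rw [hmem] at hPH
    refine ⟨interleave n (p, q), ?_, ?_⟩
    · rw [Set.mem_ofPred_eq, Q_eq_dotProduct, evenPart_interleave, oddPart_interleave]
      exact (show ∀ c : ZMod 2, c ≠ 0 → c = 1 by decide) _ hPH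
    · rw [antiflagMap_eq, evenPart_interleave, oddPart_interleave]
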